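/- arXiv:1804.01602 — 2 statements merged into one kernel-verified Lean document; each statement's English description precedes it below -/
import Mathlib

section
/- Let q be a prime, χ a nontrivial Dirichlet character modulo q, and d a positive integer with gcd(d, q) = 1. Then for all integers n and c, Σ_{γ ∈ (ℤ/dqℤ)ˣ} χ(γ) e(γ' n q / d) e(c γ / (q d)) = τ(χ) · χ̄(c) · χ(d) · S(n, c, d), where γ' denotes an integer with γ γ' ≡ 1 (mod d). -/
/-- `e(x) = exp(2πix)`. -/
noncomputable def e (x : ℂ) : ℂ := Complex.exp (2 * Real.pi * Complex.I * x)

/-- The (untwisted) Kloosterman sum `S(m, n, d) = Σ_{x ∈ (ℤ/dℤ)ˣ} e((m x + n x⁻¹)/d)`. -/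
noncomputable def Skl (m n : ℤ) (d : ℕ) : ℂ :=
  ∑ᶠ x : (ZMod d)ˣ,
    e ((m * ((x : ZMod d).val : ℂ) + n * (((x⁻¹ : (ZMod d)ˣ) : ZMod d).val : ℂ)) / (d : ℂ))

/-- The Gauss sum `τ(χ) = Σ_{x mod q} χ(x) e(x/q)`. -/
noncomputable def gaussSumE {q : ℕ} (χ : DirichletCharacter ℂ q) : ℂ :=
  ∑ᶠ x : ZMod q, χ x * e ((x.val : ℂ) / (q : ℂ))

lemma e_int_div (N : ℕ) [NeZero N] (k : ℤ) :
    e ((k : ℂ) / (N : ℂ)) = ZMod.stdAddChar (k : ZMod N) := by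
  rw [ZMod.stdAddChar_coe, e, mul_div_assoc]

lemma e_add (x y : ℂ) : e (x + y) = e x * e y := by
  rw [e, e, e, mul_add, Complex.exp_add]

lemma e_split (q d : ℕ) [NeZero q] [NeZero d] (hdq : Nat.Coprime d q) (c : ℤ) (g : ℕ)
    (uq : (ZMod d)ˣ) (ud : (ZMod q)ˣ) (huq : (uq : ZMod d) = q) (hud : (ud : ZMod q) = d) :
    e ((c * (g : ℂ)) / ((q : ℂ) * d)) =
      ZMod.stdAddChar ((c : ZMod d) * (g : ZMod d) * ((uq⁻¹ : (ZMod d)ˣ) : ZMod d)) *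
      ZMod.stdAddChar ((c : ZMod q) * (g : ZMod q) * ((ud⁻¹ : (ZMod q)ˣ) : ZMod q)) := by
  obtain ⟨B, hB⟩ := ZMod.intCast_surjective ((g : ZMod d) * ((uq⁻¹ : (ZMod d)ˣ) : ZMod d))
  obtain ⟨A, hA⟩ := ZMod.intCast_surjective ((g : ZMod q) * ((ud⁻¹ : (ZMod q)ˣ) : ZMod q))
  have h1 : (d : ℤ) ∣ g - (d * A + q * B) := by
    rw [← ZMod.intCast_zmod_eq_zero_iff_dvd]
    push_cast
    rw [hB, ← huq, ZMod.natCast_self, mul_comm (uq : ZMod d), mul_assoc, Units.inv_mul]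
    simp
  have h2 : (q : ℤ) ∣ g - (d * A + q * B) := by
    rw [← ZMod.intCast_zmod_eq_zero_iff_dvd]
    push_cast
    rw [hA, ← hud, ZMod.natCast_self, mul_comm (ud : ZMod q), mul_assoc, Units.inv_mul]
    simp
  obtain ⟨k, hk⟩ := (Nat.isCoprime_iff_coprime.mpr hdq).mul_dvd h1 h2
  have hg : (g : ℂ) = d * A + q * B + d * q * k := by
    have : (g : ℤ) = d * A + q * B + d * q * k := by linarith
    exact_mod_cast this
  have hq0 : (q : ℂ) ≠ 0 := NeZero.ne _
  have hd0 : (d : ℂ) ≠ 0 := NeZero.ne _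
  have : (c * (g : ℂ)) / ((q : ℂ) * d) =
      ((c * B : ℤ) : ℂ) / d + ((c * A + q * (c * k) : ℤ) : ℂ) / q := by
    rw [hg]; push_cast; field_simp; ring
  rw [this, e_add, e_int_div, e_int_div]
  push_cast
  rw [hA, hB, ZMod.natCast_self]
  simp [mul_assoc]

lemma gauss_part (q : ℕ) (hq : q.Prime) [NeZero q] (χ : DirichletCharacter ℂ q) (hχ : χ ≠ 1)
    (c : ℤ) (ud : (ZMod q)ˣ) :
    ∑ y : (ZMod q)ˣ, χ y * ZMod.stdAddChar ((c : ZMod q) * (y : ZMod q) * ((ud⁻¹ : (ZMod q)ˣ) : ZMod q)) =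
      gaussSumE χ * (starRingEnd ℂ) (χ (c : ZMod q)) * χ (ud : ZMod q) := by
  have : Fact q.Prime := ⟨hq⟩
  have hG : gaussSumE χ = gaussSum χ ZMod.stdAddChar := by
    rw [gaussSumE, finsum_eq_sum_of_fintype, gaussSum]
    refine Finset.sum_congr rfl fun x _ => ?_
    have := e_int_div q (x.val : ℤ)
    simp only [Int.cast_natCast, ZMod.natCast_zmod_val] at this
    rw [this]
  have hsum : ∑ y : (ZMod q)ˣ, χ y * ZMod.stdAddChar ((c : ZMod q) * (y : ZMod q) * ((ud⁻¹ : (ZMod q)ˣ) : ZMod q)) =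
      gaussSum χ (ZMod.stdAddChar.mulShift ((c : ZMod q) * ((ud⁻¹ : (ZMod q)ˣ) : ZMod q))) := by
    rw [gaussSum]
    refine Fintype.sum_of_injective (fun y : (ZMod q)ˣ => (y : ZMod q)) Units.val_injective _ _ ?_ ?_
    · intro y hy
      rw [χ.map_nonunit, zero_mul]
      rintro ⟨u, rfl⟩
      exact hy ⟨u, rfl⟩
    · intro y
      rw [AddChar.mulShift_apply]
      congr 2
      ring
  have hstar : (starRingEnd ℂ) (χ (c : ZMod q)) = χ⁻¹ (c : ZMod q) := MulChar.star_apply' χ _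
  rw [hsum, hG, hstar]
  by_cases hc : (c : ZMod q) = 0
  · rw [hc, zero_mul, AddChar.mulShift_zero, gaussSum_one_right hχ, MulChar.map_zero]
    simp
  · obtain ⟨u, hu⟩ := isUnit_iff_ne_zero.mpr hc
    rw [← hu, ← Units.val_mul, gaussSum_mulShift_eq, Units.val_mul, map_mul]
    have : χ⁻¹ ((ud⁻¹ : (ZMod q)ˣ) : ZMod q) = χ ud := by
      rw [MulChar.inv_apply, Ring.inverse_unit, inv_inv]
    rw [this]
    ring

lemma kl_part (q d : ℕ) [NeZero q] [NeZero d] (n c : ℤ) 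
    (uq : (ZMod d)ˣ) (huq : (uq : ZMod d) = q) :
    ∑ x : (ZMod d)ˣ, e ((((x : ZMod d)⁻¹.val : ℂ) * n * q) / (d : ℂ)) *
      ZMod.stdAddChar ((c : ZMod d) * (x : ZMod d) * ((uq⁻¹ : (ZMod d)ˣ) : ZMod d)) = Skl n c d := by
  rw [Skl, finsum_eq_sum_of_fintype]
  refine Fintype.sum_equiv ((Equiv.inv _).trans (Equiv.mulRight uq)) _ _ fun x => ?_
  have h1 := e_int_div d (((x : ZMod d)⁻¹.val : ℤ) * n * q)
  set y : (ZMod d)ˣ := ((Equiv.inv _).trans (Equiv.mulRight uq)) x with hy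
  have hy' : y = x⁻¹ * uq := rfl
  have h2 := e_int_div d (n * ((y : ZMod d).val : ℤ) + c * (((y⁻¹ : (ZMod d)ˣ) : ZMod d).val : ℤ))
  push_cast at h1 h2
  rw [h1, h2, ← AddChar.map_add_eq_mul]
  simp only [ZMod.natCast_zmod_val, ZMod.inv_coe_unit]
  rw [hy', ← huq]
  congr 1
  rw [mul_inv, inv_inv]
  push_cast
  ring

/-- For `q` prime, `χ` nontrivial mod `q`, `(d, q) = 1`:
`Σ_{γ ∈ (ℤ/dqℤ)ˣ} χ(γ) e(γ' n q / d) e(c γ / (q d)) = τ(χ) χ̄(c) χ(d) S(n, c, d)`,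
where `γ'` is the inverse of `γ` modulo `d`. -/
theorem twisted_sum_eq_gauss_mul_kloosterman
    (q : ℕ) (hq : q.Prime) (χ : DirichletCharacter ℂ q) (hχ : χ ≠ 1)
    (d : ℕ) (hd : 0 < d) (hdq : Nat.Coprime d q) (n c : ℤ) :
    (∑ᶠ γ : (ZMod (d * q))ˣ,
      χ (((γ : ZMod (d * q)).val : ZMod q)) *
        e (((((((γ : ZMod (d * q)).val : ZMod d))⁻¹).val : ℂ) * n * q) / (d : ℂ)) *
        e ((c * ((γ : ZMod (d * q)).val : ℂ)) / ((q : ℂ) * d)))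
      = gaussSumE χ * (starRingEnd ℂ) (χ (c : ZMod q)) * χ (d : ZMod q) * Skl n c d := by
  have : NeZero q := ⟨hq.ne_zero⟩
  have : NeZero d := ⟨hd.ne'⟩
  have : NeZero (d * q) := ⟨mul_ne_zero hd.ne' hq.ne_zero⟩
  obtain ⟨uq, huq⟩ : ∃ u : (ZMod d)ˣ, (u : ZMod d) = q :=
    ⟨ZMod.unitOfCoprime q hdq.symm, ZMod.coe_unitOfCoprime _ _⟩
  obtain ⟨ud, hud⟩ : ∃ u : (ZMod q)ˣ, (u : ZMod q) = d :=
    ⟨ZMod.unitOfCoprime d hdq, ZMod.coe_unitOfCoprime _ _⟩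
  rw [← hud, ← gauss_part q hq χ hχ c ud, ← kl_part q d n c uq huq, finsum_eq_sum_of_fintype,
    mul_comm (Finset.sum _ fun y : (ZMod q)ˣ => _), Finset.sum_mul_sum, ← Fintype.sum_prod_type']
  let E : (ZMod (d * q))ˣ ≃* (ZMod d)ˣ × (ZMod q)ˣ :=
    (Units.mapEquiv (ZMod.chineseRemainder hdq).toMulEquiv).trans MulEquiv.prodUnits
  refine Fintype.sum_equiv E.toEquiv _ _ fun γ => ?_
  have hE : ZMod.chineseRemainder hdq (γ : ZMod (d * q)) =
      (((γ : ZMod (d * q)).val : ℕ) : ZMod d × ZMod q) := by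
    conv_lhs => rw [← ZMod.natCast_zmod_val (γ : ZMod (d * q))]
    exact map_natCast _ _
  have h1 : (((E.toEquiv γ).1 : (ZMod d)ˣ) : ZMod d) = ((γ : ZMod (d * q)).val : ZMod d) :=
    congrArg Prod.fst hE
  have h2 : (((E.toEquiv γ).2 : (ZMod q)ˣ) : ZMod q) = ((γ : ZMod (d * q)).val : ZMod q) :=
    congrArg Prod.snd hE
  rw [h1, h2, e_split q d hdq c _ uq ud huq hud]
  ring
end

section
/- Let x > 0 be real and ε ∈ {+1, −1}. Let 𝒞 be the upward-oriented piecewise-linear contour consisting of the vertical ray from −3/5 − i∞ to −3/5 − i, the segment from −3/5 − i to 1/10, the segment from 1/10 to −3/5 + i, and the vertical ray from −3/5 + i to −3/5 + i∞. Then the integral (1/2πi) ∫_𝒞 Γ(ξ) (2π)^{−ξ} e^{ε iπξ/2} x^{−ξ} dξ converges absolutely on each piece and equals e^{2πi ε x}. -/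
open MeasureTheory

/-- The integrand `f(ξ) = Γ(ξ) (2π)^{−ξ} e^{ε iπξ/2} x^{−ξ}`. -/
noncomputable def f9 (x : ℝ) (ε : ℤ) (ξ : ℂ) : ℂ :=
  Complex.Gamma ξ * (2 * Real.pi : ℂ) ^ (-ξ) *
    Complex.exp (ε * Real.pi * Complex.I * ξ / 2) * (x : ℂ) ^ (-ξ)

section Helpers
open Filter Topology Set

lemma c9_tend : Tendsto (fun n : ℕ => 1 / ((n:ℝ) + 2)) atTop (𝓝 0) := by
  have h : Tendsto (fun n : ℕ => (n:ℝ) + 2) atTop atTop :=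
    tendsto_atTop_add_const_right _ _ tendsto_natCast_atTop_atTop
  simp only [one_div]
  exact h.inv_tendsto_atTop

lemma c9_exp_bound (z : ℂ) (hz : 0 ≤ z.re) (hz2 : ‖z‖ ≤ 2) (y : ℝ) (hy : 0 < y) :
    ‖Complex.exp (-z * y) - 1‖ ≤ min 2 (4 * y) := by
  have h2 : ‖Complex.exp (-z * y) - 1‖ ≤ 2 := by
    refine (norm_sub_le _ _).trans ?_
    rw [Complex.norm_exp]
    have : Real.exp ((-z * y).re) ≤ 1 := by
      rw [Real.exp_le_one_iff]; simp; positivity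
    simp only [norm_one]; linarith
  refine le_min h2 ?_
  by_cases h : y ≤ 1 / 2
  · have h3 : ‖-z * (y:ℂ)‖ ≤ 2 * y := by
      rw [norm_mul, norm_neg, Complex.norm_real, Real.norm_of_nonneg hy.le]
      gcongr
    have := Complex.norm_exp_sub_one_le (x := -z * y) (by linarith)
    linarith
  · linarith

lemma c9_conv (g : ℝ → ℂ) (hg : Continuous g)
    (hb : ∀ y > 0, ‖g y‖ ≤ min 2 (4 * y)) (s : ℂ) (h1 : -1 < s.re) (h0 : s.re < 0) :
    MellinConvergent g s := by
  apply mellinConvergent_of_isBigO_rpow (a := 0) (b := -1) _ _ h0 _ h1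
  · exact (hg.locallyIntegrable).locallyIntegrableOn _
  · refine Asymptotics.IsBigO.of_bound 2 ?_
    filter_upwards [eventually_gt_atTop 0] with y hy
    have := (hb y hy).trans (min_le_left _ _)
    simpa using this
  · refine Asymptotics.IsBigO.of_bound 4 ?_
    filter_upwards [self_mem_nhdsWithin] with y hy
    have := (hb y hy).trans (min_le_right _ _)
    have hy' : (0:ℝ) < y := hy
    simpa [abs_of_pos hy'] using this

lemma c9_conv_min (s : ℂ) (h1 : -1 < s.re) (h0 : s.re < 0) :
    MellinConvergent (fun y : ℝ => ((min 2 (4 * y) : ℝ) : ℂ)) s := by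
  have : MellinConvergent (fun y : ℝ => ((max 0 (min 2 (4 * y)) : ℝ) : ℂ)) s := by
    apply c9_conv _ (by fun_prop) _ s h1 h0
    intro y hy
    have : 0 ≤ min 2 (4 * y) := by positivity
    rw [max_eq_right this, Complex.norm_real, Real.norm_of_nonneg this]
  refine this.congr_fun ?_ measurableSet_Ioi
  intro y hy
  have hy' : (0:ℝ) < y := hy
  have : 0 ≤ min 2 (4 * y) := by positivity
  simp only [max_eq_right this]

lemma c9_mellin_one (s : ℂ) (h1 : -1 < s.re) (h0 : s.re < 0) :
    mellin (fun y : ℝ => Complex.exp (-(1:ℂ) * y) - 1) s = Complex.Gamma s := by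
  have hs : s ≠ 0 := by rintro rfl; simp at h0
  have hb := c9_exp_bound 1 (by simp) (by simp)
  have hconv : MellinConvergent (fun y : ℝ => Complex.exp (-(1:ℂ) * y) - 1) s :=
    c9_conv _ (by fun_prop) hb s h1 h0
  have hG : Complex.Gamma s = Complex.Gamma (s + 1) / s := by
    rw [Complex.Gamma_add_one s hs]; field_simp
  have hint := Complex.GammaIntegral_convergent (s := s + 1) (by simp; linarith)
  have key := integral_Ioi_mul_deriv_eq_deriv_mul (a := 0) (a' := (0:ℂ)) (b' := 0)
    (u := fun y : ℝ => Complex.exp (-(1:ℂ) * y) - 1)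
    (u' := fun y : ℝ => -Complex.exp (-(1:ℂ) * y))
    (v := fun y : ℝ => (y : ℂ) ^ s / s) (v' := fun y : ℝ => (y : ℂ) ^ (s - 1)) ?_ ?_ ?_ ?_ ?_ ?_
  · unfold mellin
    have e1 : ∀ y : ℝ, (y : ℂ) ^ (s - 1) • (Complex.exp (-(1:ℂ) * y) - 1) =
       (Complex.exp (-(1:ℂ) * y) - 1) * (y : ℂ) ^ (s - 1) := fun y => by rw [smul_eq_mul, mul_comm]
    simp_rw [e1]
    rw [key, hG, Complex.Gamma_eq_integral (by simp; linarith), Complex.GammaIntegral]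
    rw [sub_zero, zero_sub, ← integral_neg, ← integral_div]
    congr 1
    ext y
    simp
    ring
  · intro y _
    have h : HasDerivAt (fun y : ℝ => -(1:ℂ) * (y:ℂ)) (-(1:ℂ)) y := by
      simpa using (Complex.ofRealCLM.hasDerivAt (x := y)).const_mul (-(1:ℂ))
    simpa using (h.cexp).sub_const 1
  · intro y hy
    have := (hasDerivAt_ofReal_cpow_const' (x := y) (r := s - 1) (ne_of_gt hy) (by simpa using hs))
    simpa using this
  · refine hconv.congr_fun ?_ measurableSet_Ioi
    intro y _
    simp [mul_comm]
  · have hi : IntegrableOn (fun y : ℝ => -(((Real.exp (-y) : ℝ) : ℂ) * (y:ℂ) ^ (s + 1 - 1) / s))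
        (Ioi 0) := (hint.div_const s).neg
    refine hi.congr_fun ?_ measurableSet_Ioi
    intro y _
    simp
    ring
  · apply squeeze_zero_norm' (a := fun y : ℝ => 4 / ‖s‖ * y ^ (1 + s.re))
    · filter_upwards [self_mem_nhdsWithin] with y hy
      have hy' : (0:ℝ) < y := hy
      simp only [Pi.mul_apply]
      rw [norm_mul, norm_div, Complex.norm_cpow_eq_rpow_re_of_pos hy', Real.rpow_add hy', Real.rpow_one]
      have := (hb y hy').trans (min_le_right _ _)
      calc _ ≤ (4 * y) * (y ^ s.re / ‖s‖) := by gcongr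
        _ = _ := by ring
    · have : ContinuousAt (fun y : ℝ => 4 / ‖s‖ * y ^ (1 + s.re)) 0 := by
        apply ContinuousAt.mul continuousAt_const
        apply Real.continuousAt_rpow_const; right; linarith
      have h := this.tendsto
      rw [Real.zero_rpow (by linarith), mul_zero] at h
      exact h.mono_left nhdsWithin_le_nhds
  · apply squeeze_zero_norm' (a := fun y : ℝ => 2 / ‖s‖ * y ^ (-(-s.re)))
    · filter_upwards [eventually_gt_atTop 0] with y hy'
      simp only [Pi.mul_apply]
      rw [norm_mul, norm_div, Complex.norm_cpow_eq_rpow_re_of_pos hy', neg_neg]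
      have := (hb y hy').trans (min_le_left _ _)
      calc _ ≤ 2 * (y ^ s.re / ‖s‖) := by gcongr
        _ = _ := by ring
    · simpa using (tendsto_rpow_neg_atTop (y := -s.re) (by linarith)).const_mul (2 / ‖s‖)

lemma c9_mellin_real (s : ℂ) (h1 : -1 < s.re) (h0 : s.re < 0) (r : ℝ) (hr : 0 < r) :
    mellin (fun y : ℝ => Complex.exp (-(r:ℂ) * y) - 1) s = Complex.Gamma s * (r : ℂ) ^ (-s) := by
  have := mellin_comp_mul_left (fun y : ℝ => Complex.exp (-(1:ℂ) * y) - 1) s hr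
  rw [c9_mellin_one s h1 h0, smul_eq_mul, mul_comm] at this
  rw [← this]
  congr 1
  ext y
  simp

lemma c9_mellin_diff (s : ℂ) (h1 : -1 < s.re) (h0 : s.re < 0) :
    DifferentiableOn ℂ (fun z => mellin (fun y : ℝ => Complex.exp (-z * y) - 1) s)
      ({z | 0 < z.re} ∩ Metric.ball 0 2) := by
  intro z hz
  apply DifferentiableAt.differentiableWithinAt
  have hz0 : 0 < z.re := hz.1
  have hz2 : ‖z‖ ≤ 2 := by
    have := hz.2
    rw [Metric.mem_ball, dist_zero_right] at this
    exact this.le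
  have hconv : ∀ w : ℂ, 0 ≤ w.re → ‖w‖ ≤ 2 →
      MellinConvergent (fun y : ℝ => Complex.exp (-w * y) - 1) s := fun w hw hw2 =>
    c9_conv _ (by fun_prop) (c9_exp_bound w hw hw2) s h1 h0
  have hop : IsOpen ({z : ℂ | 0 < z.re} ∩ Metric.ball 0 2) :=
    (isOpen_lt continuous_const Complex.continuous_re).inter Metric.isOpen_ball
  have hopb : IsOpen {w : ℂ | z.re / 2 < w.re} := isOpen_lt continuous_const Complex.continuous_re
  have hmeas : AEStronglyMeasurable (fun y : ℝ => (y : ℂ) ^ (s - 1)) (volume.restrict (Ioi 0)) := by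
    apply ContinuousOn.aestronglyMeasurable _ measurableSet_Ioi
    intro y hy
    apply ContinuousAt.continuousWithinAt
    exact Complex.continuousAt_ofReal_cpow_const y _ (Or.inr (ne_of_gt hy))
  have key := hasDerivAt_integral_of_dominated_loc_of_deriv_le (μ := volume.restrict (Ioi (0:ℝ)))
    (F := fun (z : ℂ) (y : ℝ) => (y : ℂ) ^ (s - 1) • (Complex.exp (-z * y) - 1))
    (F' := fun (z : ℂ) (y : ℝ) => (y : ℂ) ^ (s - 1) • (Complex.exp (-z * y) * (-y)))
    (x₀ := z) (s := {w : ℂ | z.re / 2 < w.re})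
    (bound := fun y : ℝ => y ^ s.re * Real.exp (-(z.re / 2) * y ^ (1:ℝ)))
    (hopb.mem_nhds (by change z.re / 2 < z.re; linarith)) ?_ (hconv z hz0.le hz2) ?_ ?_ ?_ ?_
  · exact key.2.differentiableAt
  · filter_upwards [hop.mem_nhds hz] with w hw
    have := hw.2
    rw [Metric.mem_ball, dist_zero_right] at this
    exact (hconv w (le_of_lt hw.1) this.le).aestronglyMeasurable
  · apply hmeas.smul
    apply Continuous.aestronglyMeasurable
    fun_prop
  · filter_upwards [ae_restrict_mem measurableSet_Ioi] with y hy w hw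
    have hy' : (0:ℝ) < y := hy
    have hw' : z.re / 2 < w.re := hw
    rw [norm_smul, norm_mul, Complex.norm_cpow_eq_rpow_re_of_pos hy', Complex.norm_exp, norm_neg,
      Complex.norm_real, Real.norm_of_nonneg hy'.le]
    have e : (s - 1).re = s.re - 1 := by simp
    have e2 : (-w * (y:ℂ)).re = -w.re * y := by simp
    rw [e, e2, Real.rpow_sub hy', Real.rpow_one]
    have : Real.exp (-w.re * y) ≤ Real.exp (-(z.re / 2) * y) := by
      rw [Real.exp_le_exp]; nlinarith
    calc _ = y ^ s.re * Real.exp (-w.re * y) := by field_simp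
      _ ≤ _ := by gcongr
  · exact integrableOn_rpow_mul_exp_neg_mul_rpow h1 one_pos (by linarith)
  · filter_upwards with y w _
    simp only [smul_eq_mul]
    apply HasDerivAt.const_mul
    have h : HasDerivAt (fun w : ℂ => -w * (y:ℂ)) (-(y:ℂ)) w := by
      simpa using ((hasDerivAt_id w).neg.mul_const (y:ℂ))
    exact h.cexp.sub_const 1

lemma c9_mellin_half (s : ℂ) (h1 : -1 < s.re) (h0 : s.re < 0) (z : ℂ) (hz : 0 < z.re)
    (hz2 : ‖z‖ < 2) :
    mellin (fun y : ℝ => Complex.exp (-z * y) - 1) s = Complex.Gamma s * z ^ (-s) := by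
  have hop : IsOpen ({z : ℂ | 0 < z.re} ∩ Metric.ball 0 2) :=
    (isOpen_lt continuous_const Complex.continuous_re).inter Metric.isOpen_ball
  have hc : Convex ℝ ({z : ℂ | 0 < z.re} ∩ Metric.ball 0 2) :=
    (convex_halfSpace_re_gt 0).inter (convex_ball _ _)
  have hA := (c9_mellin_diff s h1 h0).analyticOnNhd hop
  have hB : AnalyticOnNhd ℂ (fun z => Complex.Gamma s * z ^ (-s)) ({z : ℂ | 0 < z.re} ∩ Metric.ball 0 2) := by
    apply DifferentiableOn.analyticOnNhd _ hop
    intro w hw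
    apply DifferentiableAt.differentiableWithinAt
    apply DifferentiableAt.const_mul
    exact (differentiableAt_id).cpow_const (Or.inl hw.1)
  have := hA.eqOn_of_preconnected_of_frequently_eq hB hc.isPreconnected (z₀ := 1) (by simp) ?_
  · exact this ⟨hz, by simpa using hz2⟩
  · have ht : Tendsto (fun n : ℕ => ((1 + 1 / ((n:ℝ) + 2) : ℝ) : ℂ)) atTop (𝓝[≠] 1) := by
      apply tendsto_nhdsWithin_of_tendsto_nhds_of_eventually_within
      · have h : Tendsto (fun n : ℕ => (1 + 1 / ((n:ℝ) + 2) : ℝ)) atTop (𝓝 (1 + 0)) :=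
          tendsto_const_nhds.add c9_tend
        rw [add_zero] at h
        exact (Complex.continuous_ofReal.tendsto 1).comp h
      · filter_upwards with n
        intro h
        have h' : (1 + 1 / ((n:ℝ) + 2) : ℝ) = 1 := by
          have h2 := mem_singleton_iff.1 h
          exact_mod_cast h2
        have : 0 < 1 / ((n:ℝ) + 2) := by positivity
        linarith
    refine ht.frequently (Frequently.of_forall fun n => ?_)
    exact c9_mellin_real s h1 h0 _ (by positivity)

lemma c9_mellin_bdry (s : ℂ) (h1 : -1 < s.re) (h0 : s.re < 0) (z : ℂ) (hz : z.re = 0)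
    (hz1 : ‖z‖ = 1) :
    mellin (fun y : ℝ => Complex.exp (-z * y) - 1) s = Complex.Gamma s * z ^ (-s) := by
  have hδ : Tendsto (fun n : ℕ => 1 / ((n:ℝ) + 2)) atTop (𝓝 0) :=
    c9_tend
  have hw : Tendsto (fun n : ℕ => z + ((1 / ((n:ℝ) + 2) : ℝ) : ℂ)) atTop (𝓝 z) := by
    have := tendsto_const_nhds (x := z).add ((Complex.continuous_ofReal.tendsto 0).comp hδ)
    simpa using this
  have hslit : z ∈ Complex.slitPlane := by
    right
    intro h
    have : z = 0 := Complex.ext hz h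
    simp [this] at hz1
  have hL : Tendsto (fun n : ℕ => Complex.Gamma s * (z + ((1 / ((n:ℝ) + 2) : ℝ) : ℂ)) ^ (-s))
      atTop (𝓝 (Complex.Gamma s * z ^ (-s))) := by
    apply Tendsto.const_mul
    exact ((continuousAt_cpow_const hslit : ContinuousAt (fun w : ℂ => w ^ (-s)) z).tendsto).comp hw
  refine tendsto_nhds_unique ?_ hL
  have hre : ∀ n : ℕ, 0 < (z + ((1 / ((n:ℝ) + 2) : ℝ) : ℂ)).re := by
    intro n
    rw [Complex.add_re, hz, Complex.ofReal_re]; positivity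
  have hlt : ∀ n : ℕ, ‖z + ((1 / ((n:ℝ) + 2) : ℝ) : ℂ)‖ < 2 := by
    intro n
    refine (norm_add_le _ _).trans_lt ?_
    rw [hz1, Complex.norm_real, Real.norm_of_nonneg (by positivity)]
    have : 1 / ((n:ℝ) + 2) < 1 := by
      rw [div_lt_one (by positivity)]; linarith [n.cast_nonneg (α := ℝ)]
    linarith
  have he : ∀ n : ℕ, Complex.Gamma s * (z + ((1 / ((n:ℝ) + 2) : ℝ) : ℂ)) ^ (-s)
     = mellin (fun y : ℝ => Complex.exp (-(z + ((1 / ((n:ℝ) + 2) : ℝ) : ℂ)) * y) - 1) s :=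
    fun n => (c9_mellin_half s h1 h0 _ (hre n) (hlt n)).symm
  simp_rw [he]
  unfold mellin
  apply tendsto_integral_of_dominated_convergence
    (fun y : ℝ => ‖(y : ℂ) ^ (s - 1) • ((min 2 (4 * y) : ℝ) : ℂ)‖)
  · intro n
    have hc : MellinConvergent
      (fun y : ℝ => Complex.exp (-(z + ((1 / ((n:ℝ) + 2) : ℝ) : ℂ)) * y) - 1) s := by
      apply c9_conv _ (by fun_prop) _ s h1 h0
      intro y hy
      apply c9_exp_bound _ (hre n).le _ y hy
      refine (norm_add_le _ _).trans ?_
      rw [hz1, Complex.norm_real, Real.norm_of_nonneg (by positivity)]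
      have : 1 / ((n:ℝ) + 2) ≤ 1 := by
        rw [div_le_one (by positivity)]; linarith [n.cast_nonneg (α := ℝ)]
      linarith
    exact hc.aestronglyMeasurable
  · exact (c9_conv_min s h1 h0).norm
  · intro n
    filter_upwards [ae_restrict_mem measurableSet_Ioi] with y hy
    have hy' : (0:ℝ) < y := hy
    rw [norm_smul, norm_smul]
    gcongr
    rw [Complex.norm_real, Real.norm_of_nonneg (by positivity)]
    apply c9_exp_bound _ (hre n).le _ y hy
    refine (norm_add_le _ _).trans ?_
    rw [hz1, Complex.norm_real, Real.norm_of_nonneg (by positivity)]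
    have : 1 / ((n:ℝ) + 2) ≤ 1 := by
      rw [div_le_one (by positivity)]; linarith [n.cast_nonneg (α := ℝ)]
    linarith
  · filter_upwards with y
    apply Tendsto.const_smul
    have : Continuous (fun w : ℂ => Complex.exp (-w * y) - 1) := by fun_prop
    exact (this.tendsto z).comp hw

lemma c9_factor (k u : ℝ) (hk : 0 ≤ k) (hu : 0 < u) :
    ((k + 1/2)^2 + u) / ((k + 2/5)^2 + u) ≤
      (((k + 1)^2 + u) / (k^2 + u)) ^ (1/10 : ℝ) * Real.exp (1 / (k + 2/5)^2) := by
  have hA : 0 < ((k + 2/5)^2 + u) := by positivity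
  have hB : 0 < ((k + 1)^2 + u) := by positivity
  have hC : 0 < (k^2 + u) := by positivity
  have h1 : ((k + 1/2)^2 + u) / ((k + 2/5)^2 + u) ≤
      Real.exp ((k/5 + 9/100) / ((k + 2/5)^2 + u)) := by
    refine le_trans (le_of_eq ?_) (Real.add_one_le_exp _)
    field_simp; ring
  have h2 : Real.exp ((2*k+1) / ((k + 1)^2 + u)) ≤ ((k + 1)^2 + u) / (k^2 + u) := by
    have h := Real.add_one_le_exp (-((2*k+1) / ((k + 1)^2 + u)))
    have e : -((2*k+1) / ((k + 1)^2 + u)) + 1 = (((k + 1)^2 + u) / (k^2 + u))⁻¹ := by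
      field_simp; ring
    rw [e, Real.exp_neg] at h
    exact (inv_le_inv₀ (by positivity) (Real.exp_pos _)).1 h
  have h3 : Real.exp ((2*k+1) / ((k + 1)^2 + u) * (1/10)) ≤
      (((k + 1)^2 + u) / (k^2 + u)) ^ (1/10 : ℝ) := by
    rw [Real.exp_mul]
    exact Real.rpow_le_rpow (Real.exp_pos _).le h2 (by norm_num)
  refine h1.trans (le_trans ?_ (mul_le_mul_of_nonneg_right h3 (Real.exp_pos _).le))
  rw [← Real.exp_add, Real.exp_le_exp]
  have hD : 0 < (k + 2/5)^2 := by positivity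
  have e1 : (k/5 + 9/100) / ((k + 2/5)^2 + u) - (2*k+1) / ((k + 1)^2 + u) * (1/10) ≤
     1 / ((k + 2/5)^2 + u) := by
    have : (k/5 + 9/100 - 1) / ((k + 2/5)^2 + u) ≤ (2*k+1) / ((k + 1)^2 + u) * (1/10) := by
      rw [div_mul_eq_mul_div, div_le_div_iff₀ hA hB]
      nlinarith
    rw [sub_div] at this
    linarith
  have e2 : 1 / ((k + 2/5)^2 + u) ≤ 1 / (k + 2/5)^2 := by
    apply one_div_le_one_div_of_le hD; linarith
  linarith

lemma c9_summable : Summable (fun k : ℕ => 1 / ((k:ℝ) + 2/5)^2) := by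
  have h := (Real.summable_one_div_nat_add_rpow (2/5) 2).2 (by norm_num)
  refine h.congr fun k => ?_
  rw [abs_of_nonneg (by positivity)]
  norm_num

lemma c9_prod (u : ℝ) (hu : 0 < u) (n : ℕ) :
    ∏ k ∈ Finset.range n, (((k:ℝ) + 1/2)^2 + u) / ((k + 2/5)^2 + u) ≤
      (((n:ℝ)^2 + u) / u) ^ (1/10 : ℝ) * Real.exp (∑' k : ℕ, 1 / ((k:ℝ) + 2/5)^2) := by
  have h : ∏ k ∈ Finset.range n, (((k:ℝ) + 1/2)^2 + u) / ((k + 2/5)^2 + u) ≤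
      (((n:ℝ)^2 + u) / u) ^ (1/10 : ℝ) *
        Real.exp (∑ k ∈ Finset.range n, 1 / ((k:ℝ) + 2/5)^2) := by
    induction n with
    | zero => simp [hu.ne']
    | succ n ih =>
      rw [Finset.prod_range_succ, Finset.sum_range_succ, Real.exp_add]
      refine (mul_le_mul ih (c9_factor n u n.cast_nonneg hu) (by positivity) (by positivity)).trans
        (le_of_eq ?_)
      have : ((((n+1 : ℕ):ℝ)^2 + u) / u) = (((n:ℝ)^2 + u) / u) * ((((n:ℝ) + 1)^2 + u) / ((n:ℝ)^2 + u)) := by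
        push_cast; field_simp
      rw [this, Real.mul_rpow (by positivity) (by positivity)]
      ring
  refine h.trans ?_
  gcongr
  exact c9_summable.sum_le_tsum _ (fun k _ => by positivity)

lemma c9_gs (a t : ℝ) (n : ℕ) (hn : 0 < n) :
    ‖Complex.GammaSeq (a + t * Complex.I) n‖ ^ 2 =
      ((n:ℝ) ^ a * n.factorial) ^ 2 / ∏ k ∈ Finset.range (n + 1), (((k:ℝ) + a)^2 + t^2) := by
  unfold Complex.GammaSeq
  rw [norm_div, norm_mul, norm_prod, div_pow, ← Finset.prod_pow,
    Complex.norm_natCast_cpow_of_pos hn]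
  congr 1
  · simp
  · apply Finset.prod_congr rfl
    intro k _
    rw [Complex.sq_norm, Complex.normSq_apply]
    simp
    ring

lemma c9_ratio (t : ℝ) (ht : t ≠ 0) :
    ‖Complex.Gamma (((2/5 : ℝ) : ℂ) + t * Complex.I)‖ ^ 2 ≤
      ((t^2)⁻¹ ^ (1/10 : ℝ) * Real.exp (∑' k : ℕ, 1 / ((k:ℝ) + 2/5)^2)) *
       ‖Complex.Gamma (((1/2 : ℝ) : ℂ) + t * Complex.I)‖ ^ 2 := by
  have hu : 0 < t^2 := by positivity
  set E := Real.exp (∑' k : ℕ, 1 / ((k:ℝ) + 2/5)^2) with hE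
  have hE0 : 0 < E := Real.exp_pos _
  have hl : Tendsto (fun n : ℕ => ‖Complex.GammaSeq (((2/5 : ℝ) : ℂ) + t * Complex.I) n‖ ^ 2) atTop
     (𝓝 (‖Complex.Gamma (((2/5 : ℝ) : ℂ) + t * Complex.I)‖ ^ 2)) :=
    ((Complex.GammaSeq_tendsto_Gamma _).norm).pow 2
  have hr : Tendsto (fun n : ℕ => ‖Complex.GammaSeq (((1/2 : ℝ) : ℂ) + t * Complex.I) n‖ ^ 2) atTop
     (𝓝 (‖Complex.Gamma (((1/2 : ℝ) : ℂ) + t * Complex.I)‖ ^ 2)) :=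
    ((Complex.GammaSeq_tendsto_Gamma _).norm).pow 2
  have hq : Tendsto (fun n : ℕ => (((1 + 1 / (n:ℝ))^2 + t^2 * (1 / (n:ℝ))^2) / t^2) ^ (1/10 : ℝ) * E)
     atTop (𝓝 ((t^2)⁻¹ ^ (1/10 : ℝ) * E)) := by
    apply Tendsto.mul_const
    have h0 : Tendsto (fun n : ℕ => 1 / (n:ℝ)) atTop (𝓝 0) := tendsto_one_div_atTop_nhds_zero_nat
    have hc : ContinuousAt (fun v : ℝ => (((1 + v)^2 + t^2 * v^2) / t^2) ^ (1/10 : ℝ)) 0 := by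
      apply ContinuousAt.rpow_const (by fun_prop) (Or.inr (by norm_num))
    have := hc.tendsto.comp h0
    simpa [Function.comp_def] using this
  refine le_of_tendsto_of_tendsto hl (hq.mul hr) ?_
  filter_upwards [eventually_gt_atTop 0] with n hn
  have hn' : (0:ℝ) < n := by exact_mod_cast hn
  rw [c9_gs _ t n hn, c9_gs _ t n hn]
  have hp := c9_prod (t^2) hu (n+1)
  rw [Finset.prod_div_distrib] at hp
  set P := ∏ k ∈ Finset.range (n+1), (((k:ℝ) + 1/2)^2 + t^2) with hP
  set Q := ∏ k ∈ Finset.range (n+1), (((k:ℝ) + 2/5)^2 + t^2) with hQ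
  have hP0 : 0 < P := Finset.prod_pos fun k _ => by positivity
  have hQ0 : 0 < Q := Finset.prod_pos fun k _ => by positivity
  have e : (((n+1 : ℕ):ℝ)^2 + t^2) / t^2 =
     (n:ℝ)^2 * (((1 + 1 / (n:ℝ))^2 + t^2 * (1 / (n:ℝ))^2) / t^2) := by
    push_cast; field_simp
  rw [e, Real.mul_rpow (by positivity) (by positivity)] at hp
  set R := (((1 + 1 / (n:ℝ))^2 + t^2 * (1 / (n:ℝ))^2) / t^2) ^ (1/10 : ℝ)
  have e2 : ((n:ℝ)^(1/2:ℝ))^2 = ((n:ℝ)^(2/5:ℝ))^2 * ((n:ℝ)^2)^(1/10:ℝ) := by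
    simp only [← Real.rpow_natCast]
    rw [← Real.rpow_mul hn'.le, ← Real.rpow_mul hn'.le, ← Real.rpow_mul hn'.le, ← Real.rpow_add hn']
    norm_num
  rw [mul_pow, mul_pow, e2]
  rw [div_le_iff₀ hQ0] at hp
  have hF : 0 < ((n:ℝ)^(2/5:ℝ))^2 * (n.factorial : ℝ)^2 := by positivity
  rw [← mul_div_assoc, div_le_div_iff₀ hQ0 hP0]
  calc _ ≤ ((n:ℝ)^(2/5:ℝ))^2 * (n.factorial : ℝ)^2 * (((n:ℝ)^2)^(1/10:ℝ) * R * E * Q) := by gcongr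
    _ = _ := by ring

lemma c9_half (t : ℝ) : ‖Complex.Gamma (((1/2 : ℝ) : ℂ) + t * Complex.I)‖ ^ 2 ≤
    2 * Real.pi * Real.exp (-Real.pi * |t|) := by
  have h := Complex.Gamma_mul_Gamma_one_sub (((1/2 : ℝ) : ℂ) + t * Complex.I)
  have e : 1 - (((1/2 : ℝ) : ℂ) + t * Complex.I) =
      (starRingEnd ℂ) (((1/2 : ℝ) : ℂ) + t * Complex.I) := by
    apply Complex.ext <;> simp; norm_num
  rw [e, Complex.Gamma_conj, Complex.mul_conj] at h
  have e2 : Complex.sin (Real.pi * (((1/2 : ℝ) : ℂ) + t * Complex.I)) = (Real.cosh (Real.pi * t) : ℂ) := by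
    have : (Real.pi * (((1/2 : ℝ) : ℂ) + t * Complex.I)) = (Real.pi * t : ℂ) * Complex.I + Real.pi / 2 := by
      push_cast; ring
    rw [this, Complex.sin_add_pi_div_two, Complex.cos_mul_I]
    push_cast; rfl
  rw [e2] at h
  have h' : Complex.normSq (Complex.Gamma (((1/2 : ℝ) : ℂ) + t * Complex.I)) = Real.pi / Real.cosh (Real.pi * t) := by
    exact_mod_cast h
  rw [Complex.sq_norm, h', div_le_iff₀ (Real.cosh_pos _)]
  have hc : Real.exp (Real.pi * |t|) / 2 ≤ Real.cosh (Real.pi * t) := by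
    rw [← Real.cosh_abs, abs_mul, abs_of_pos Real.pi_pos, Real.cosh_eq]
    have := Real.exp_pos (-(Real.pi * |t|))
    linarith
  calc Real.pi = 2 * Real.pi * Real.exp (-Real.pi * |t|) * (Real.exp (Real.pi * |t|) / 2) := by
        rw [neg_mul, Real.exp_neg]; field_simp
    _ ≤ _ := by gcongr

lemma c9_gamma_bound : ∃ C : ℝ, 0 < C ∧ ∀ t : ℝ, 1 ≤ |t| →
    ‖Complex.Gamma ((-(3 / 5) : ℂ) + t * Complex.I)‖ ≤
      C * |t| ^ (-(11/10) : ℝ) * Real.exp (-Real.pi * |t| / 2) := by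
  set E := Real.exp (∑' k : ℕ, 1 / ((k:ℝ) + 2/5)^2) with hE
  have hE0 : 0 < E := Real.exp_pos _
  have hpi := Real.pi_pos
  refine ⟨Real.sqrt (E * (2 * Real.pi)), by positivity, fun t ht => ?_⟩
  have ht0 : 0 < |t| := by linarith
  have htne : t ≠ 0 := abs_pos.1 ht0
  have h1 := (c9_ratio t htne).trans (mul_le_mul_of_nonneg_left (c9_half t) (by positivity))
  have h2 : ‖Complex.Gamma (((2/5 : ℝ) : ℂ) + t * Complex.I)‖ ≤
     Real.sqrt (E * (2 * Real.pi)) * |t| ^ (-(1/10) : ℝ) * Real.exp (-Real.pi * |t| / 2) := by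
    apply le_of_sq_le_sq _ (by positivity)
    refine h1.trans (le_of_eq ?_)
    rw [mul_pow, mul_pow, Real.sq_sqrt (by positivity), ← Real.exp_nat_mul, ← sq_abs t]
    have : (((|t|)^2)⁻¹) ^ (1/10:ℝ) = (|t| ^ (-(1/10) : ℝ))^2 := by
      rw [Real.rpow_neg ht0.le, inv_pow, Real.inv_rpow (by positivity)]
      congr 1
      simp only [← Real.rpow_natCast]
      rw [← Real.rpow_mul ht0.le, ← Real.rpow_mul ht0.le]; norm_num
    rw [this]
    have e : ((2:ℕ):ℝ) * (-Real.pi * |t| / 2) = -Real.pi * |t| := by push_cast; ring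
    rw [e]; ring
  set s : ℂ := (-(3 / 5) : ℂ) + t * Complex.I with hs
  have hsn : |t| ≤ ‖s‖ := by
    have := Complex.abs_im_le_norm s
    simpa [hs] using this
  have hs0 : s ≠ 0 := by
    intro h; rw [h, norm_zero] at hsn; linarith
  have e : (((2/5 : ℝ) : ℂ) + t * Complex.I) = s + 1 := by rw [hs]; push_cast; ring
  rw [e, Complex.Gamma_add_one s hs0, norm_mul] at h2
  have h3 : |t| * ‖Complex.Gamma s‖ ≤ _ := (mul_le_mul_of_nonneg_right hsn (norm_nonneg _)).trans h2
  have e3 : |t| ^ (-(11/10) : ℝ) = |t| ^ (-(1/10) : ℝ) / |t| := by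
    rw [show (-(11/10) : ℝ) = -(1/10) - 1 by norm_num, Real.rpow_sub ht0, Real.rpow_one]
  rw [e3]
  rw [mul_comm, ← le_div_iff₀ ht0] at h3
  refine h3.trans (le_of_eq (by ring))

lemma c9_two_pi_ne : (2 * Real.pi : ℂ) ≠ 0 := by
  simp [Real.pi_ne_zero]

lemma c9_diff_rest (x : ℝ) (hx : 0 < x) (ε : ℤ) (ξ : ℂ) : DifferentiableAt ℂ
    (fun ξ : ℂ => (2 * Real.pi : ℂ) ^ (-ξ) *
      Complex.exp (ε * Real.pi * Complex.I * ξ / 2) * (x : ℂ) ^ (-ξ)) ξ := by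
  have hx' : (x : ℂ) ≠ 0 := by exact_mod_cast hx.ne'
  have h1 : DifferentiableAt ℂ (fun ξ : ℂ => (2 * Real.pi : ℂ) ^ (-ξ)) ξ :=
    (differentiableAt_id.neg).const_cpow (Or.inl c9_two_pi_ne)
  have h2 : DifferentiableAt ℂ (fun ξ : ℂ => (x : ℂ) ^ (-ξ)) ξ :=
    (differentiableAt_id.neg).const_cpow (Or.inl hx')
  exact (h1.mul (by fun_prop)).mul h2

lemma c9_diff (x : ℝ) (hx : 0 < x) (ε : ℤ) (ξ : ℂ) (h : -1 < ξ.re) (h0 : ξ ≠ 0) :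
    DifferentiableAt ℂ (f9 x ε) ξ := by
  have hG : DifferentiableAt ℂ Complex.Gamma ξ := by
    apply Complex.differentiableAt_Gamma
    intro m hm
    rcases Nat.eq_zero_or_pos m with rfl | hm0
    · simp at hm; exact h0 hm
    · rw [hm] at h
      have : (1:ℝ) ≤ m := by exact_mod_cast hm0
      simp at h; linarith
  refine (hG.mul (c9_diff_rest x hx ε ξ)).congr_of_eventuallyEq ?_
  filter_upwards with w
  simp only [f9, Pi.mul_apply]; ring

lemma c9_decomp (x : ℝ) (hx : 0 < x) (ε : ℤ) : ∃ H : ℂ → ℂ,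
    ∀ ξ ∈ Metric.ball (10:ℂ) (109/10), ξ ≠ 0 → HasDerivAt H (f9 x ε ξ - ξ⁻¹) ξ := by
  let g : ℂ → ℂ := fun ξ => Complex.Gamma (ξ + 1) * ((2 * Real.pi : ℂ) ^ (-ξ) *
      Complex.exp (ε * Real.pi * Complex.I * ξ / 2) * (x : ℂ) ^ (-ξ))
  have hgd : DifferentiableOn ℂ g (Metric.ball (10:ℂ) (109/10)) := by
    intro ξ hξ
    apply DifferentiableAt.differentiableWithinAt
    have hre : -1 < ξ.re := by
      have h1 : ‖ξ - 10‖ < 109/10 := by simpa [dist_eq_norm] using hξ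
      have h2 := Complex.abs_re_le_norm (ξ - 10)
      have h3 := (abs_le.1 (h2.trans h1.le)).1
      simp at h3; linarith
    have hG : DifferentiableAt ℂ (fun ξ => Complex.Gamma (ξ + 1)) ξ := by
      have : DifferentiableAt ℂ Complex.Gamma (ξ + 1) := by
        apply Complex.differentiableAt_Gamma
        intro m hm
        have := congrArg Complex.re hm
        simp at this
        have h2 : (0:ℝ) ≤ m := m.cast_nonneg
        linarith
      exact this.comp ξ (by fun_prop)
    exact hG.mul (c9_diff_rest x hx ε ξ)
  have h0 : (0:ℂ) ∈ Metric.ball (10:ℂ) (109/10) := by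
    simp; norm_num
  have hd : DifferentiableOn ℂ (dslope g 0) (Metric.ball (10:ℂ) (109/10)) :=
    (Complex.differentiableOn_dslope (Metric.isOpen_ball.mem_nhds h0)).2 hgd
  obtain ⟨H, hH⟩ := hd.isExactOn_ball
  refine ⟨H, fun ξ hξ hne => ?_⟩
  have := hH ξ hξ
  rw [dslope_of_ne _ hne, slope_def_field] at this
  have g0 : g 0 = 1 := by simp [g]
  suffices hh : f9 x ε ξ - ξ⁻¹ = (g ξ - g 0) / (ξ - 0) by rw [hh]; exact this
  rw [g0]
  simp only [g, f9, Complex.Gamma_add_one ξ hne]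
  field_simp
  ring

lemma c9_seg (f P : ℂ → ℂ) (a v : ℂ) (l r : ℝ) (hlr : l ≤ r)
    (hP : ∀ t ∈ Icc l r, HasDerivAt P (f (a + t * v)) (a + t * v))
    (hf : ∀ t ∈ Icc l r, ContinuousAt f (a + t * v)) :
    IntervalIntegrable (fun t : ℝ => f (a + t * v) * v) volume l r ∧
    ∫ t in l..r, f (a + t * v) * v = P (a + r * v) - P (a + l * v) := by
  have hi : IntervalIntegrable (fun t : ℝ => f (a + t * v) * v) volume l r := by
    apply ContinuousOn.intervalIntegrable
    rw [uIcc_of_le hlr]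
    intro t ht
    apply ContinuousAt.continuousWithinAt
    apply ContinuousAt.mul _ continuousAt_const
    exact ContinuousAt.comp (f := fun t : ℝ => a + t * v) (hf t ht) (by fun_prop)
  refine ⟨hi, ?_⟩
  refine intervalIntegral.integral_eq_sub_of_hasDerivAt (f := fun t : ℝ => P (a + t * v)) ?_ hi
  intro t ht
  rw [uIcc_of_le hlr] at ht
  have h : HasDerivAt (fun t : ℝ => a + (t:ℂ) * v) v t := by
    simpa using ((Complex.ofRealCLM.hasDerivAt (x := t)).mul_const v).const_add a
  exact (hP t ht).comp_of_eq t h rfl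

lemma c9_cont_line (x : ℝ) (hx : 0 < x) (ε : ℤ) :
    Continuous (fun t : ℝ => f9 x ε ((-(3 / 5) : ℂ) + (t : ℂ) * Complex.I)) := by
  rw [continuous_iff_continuousAt]
  intro t
  have hne : ((-(3 / 5) : ℂ) + (t : ℂ) * Complex.I) ≠ 0 := by
    intro h; have := congrArg Complex.re h; norm_num at this
  have := (c9_diff x hx ε ((-(3 / 5) : ℂ) + (t : ℂ) * Complex.I) (by norm_num) hne).continuousAt
  exact ContinuousAt.comp (f := fun t : ℝ => ((-(3 / 5) : ℂ) + (t : ℂ) * Complex.I)) this (by fun_prop)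

lemma c9_local (x : ℝ) (hx : 0 < x) (ε : ℤ) :
    IntervalIntegrable (fun t : ℝ =>
        f9 x ε (((-(3 / 5) : ℂ) - Complex.I) +
            (t : ℂ) * ((1 / 10 : ℂ) - ((-(3 / 5) : ℂ) - Complex.I))) *
          ((1 / 10 : ℂ) - ((-(3 / 5) : ℂ) - Complex.I))) volume 0 1 ∧
    IntervalIntegrable (fun t : ℝ =>
        f9 x ε ((1 / 10 : ℂ) +
            (t : ℂ) * (((-(3 / 5) : ℂ) + Complex.I) - (1 / 10 : ℂ))) *
          (((-(3 / 5) : ℂ) + Complex.I) - (1 / 10 : ℂ))) volume 0 1 ∧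
        (∫ t in (0 : ℝ)..1,
          f9 x ε (((-(3 / 5) : ℂ) - Complex.I) +
              (t : ℂ) * ((1 / 10 : ℂ) - ((-(3 / 5) : ℂ) - Complex.I))) *
            ((1 / 10 : ℂ) - ((-(3 / 5) : ℂ) - Complex.I))) +
        (∫ t in (0 : ℝ)..1,
          f9 x ε ((1 / 10 : ℂ) +
              (t : ℂ) * (((-(3 / 5) : ℂ) + Complex.I) - (1 / 10 : ℂ))) *
            (((-(3 / 5) : ℂ) + Complex.I) - (1 / 10 : ℂ))) =
        (∫ t in (-1 : ℝ)..1, f9 x ε ((-(3 / 5) : ℂ) + (t : ℂ) * Complex.I) * Complex.I)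
        + 2 * Real.pi * Complex.I := by
  obtain ⟨H, hH⟩ := c9_decomp x hx ε
  have hball : ∀ ξ : ℂ, -(3/5) ≤ ξ.re → ξ.re ≤ 1/10 → -1 ≤ ξ.im → ξ.im ≤ 1 →
      ξ ∈ Metric.ball (10:ℂ) (109/10) := by
    intro ξ h1 h2 h3 h4
    rw [Metric.mem_ball, dist_eq_norm, ← sq_lt_sq₀ (norm_nonneg _) (by norm_num), Complex.sq_norm,
      Complex.normSq_apply]
    simp
    nlinarith
  have hP1 : ∀ ξ ∈ Metric.ball (10:ℂ) (109/10), ξ ∈ Complex.slitPlane →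
      HasDerivAt (fun z => H z + Complex.log z) (f9 x ε ξ) ξ := by
    intro ξ h1 h2
    have h3 := (hH ξ h1 (Complex.slitPlane_ne_zero h2)).add (Complex.hasDerivAt_log h2)
    rw [sub_add_cancel] at h3
    exact h3
  have hP2 : ∀ ξ ∈ Metric.ball (10:ℂ) (109/10), -ξ ∈ Complex.slitPlane →
      HasDerivAt (fun z => H z + Complex.log (-z)) (f9 x ε ξ) ξ := by
    intro ξ h1 h2
    have hne : ξ ≠ 0 := by
      have := Complex.slitPlane_ne_zero h2
      simpa using this
    have hl := (hasDerivAt_neg ξ).clog h2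
    have h3 := (hH ξ h1 hne).add hl
    have e : f9 x ε ξ - ξ⁻¹ + -1 / -ξ = f9 x ε ξ := by
      rw [neg_div_neg_eq, one_div, sub_add_cancel]
    rw [e] at h3
    exact h3
  have s1 := c9_seg (f9 x ε) (fun z => H z + Complex.log z) ((-(3 / 5) : ℂ) - Complex.I)
    ((1 / 10 : ℂ) - ((-(3 / 5) : ℂ) - Complex.I)) 0 1 (by norm_num) ?_ ?_
  · have s2 := c9_seg (f9 x ε) (fun z => H z + Complex.log z) (1 / 10 : ℂ)
      (((-(3 / 5) : ℂ) + Complex.I) - (1 / 10 : ℂ)) 0 1 (by norm_num) ?_ ?_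
    · have s3 := c9_seg (f9 x ε) (fun z => H z + Complex.log (-z)) (-(3 / 5) : ℂ)
        Complex.I (-1) 1 (by norm_num) ?_ ?_
      · refine ⟨s1.1, s2.1, ?_⟩
        rw [s1.2, s2.2, s3.2]
        have a1 := Complex.arg_neg_eq_arg_sub_pi_of_im_pos
          (x := (-(3 / 5) : ℂ) + Complex.I) (by norm_num)
        have a2 := Complex.arg_neg_eq_arg_add_pi_of_im_neg
          (x := (-(3 / 5) : ℂ) - Complex.I) (by norm_num)
        have l1 : Complex.log (-((-(3 / 5) : ℂ) + Complex.I)) =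
            Complex.log ((-(3 / 5) : ℂ) + Complex.I) - Real.pi * Complex.I := by
          rw [Complex.log, Complex.log, a1, norm_neg]; push_cast; ring
        have l2 : Complex.log (-((-(3 / 5) : ℂ) - Complex.I)) =
            Complex.log ((-(3 / 5) : ℂ) - Complex.I) + Real.pi * Complex.I := by
          rw [Complex.log, Complex.log, a2, norm_neg]; push_cast; ring
        have p1 : ((-(3 / 5) : ℂ) - Complex.I) + ((1:ℝ):ℂ) * ((1 / 10 : ℂ) - ((-(3 / 5) : ℂ) - Complex.I))
          = 1 / 10 := by push_cast; ring
        have p2 : ((-(3 / 5) : ℂ) - Complex.I) + ((0:ℝ):ℂ) * ((1 / 10 : ℂ) - ((-(3 / 5) : ℂ) - Complex.I))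
          = (-(3 / 5) : ℂ) - Complex.I := by push_cast; ring
        have p3 : (1 / 10 : ℂ) + ((1:ℝ):ℂ) * (((-(3 / 5) : ℂ) + Complex.I) - (1 / 10 : ℂ))
          = (-(3 / 5) : ℂ) + Complex.I := by push_cast; ring
        have p4 : (1 / 10 : ℂ) + ((0:ℝ):ℂ) * (((-(3 / 5) : ℂ) + Complex.I) - (1 / 10 : ℂ))
          = 1 / 10 := by push_cast; ring
        have p5 : (-(3 / 5) : ℂ) + ((1:ℝ):ℂ) * Complex.I = (-(3 / 5) : ℂ) + Complex.I := by
          push_cast; ring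
        have p6 : (-(3 / 5) : ℂ) + ((-1:ℝ):ℂ) * Complex.I = (-(3 / 5) : ℂ) - Complex.I := by
          push_cast; ring
        rw [p1, p2, p3, p4, p5, p6]
        simp only [l1, l2]
        ring
      · intro t ht
        apply hP2
        · apply hball <;> norm_num <;> linarith [ht.1, ht.2]
        · left; norm_num
      · intro t ht
        apply (c9_diff x hx ε _ (by norm_num) _).continuousAt
        intro h; have := congrArg Complex.re h; norm_num at this
    · intro t ht
      apply hP1
      · apply hball <;> norm_num <;> linarith [ht.1, ht.2]
      · by_cases h : t = 0
        · left; subst h; norm_num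
        · right; norm_num; exact h
    · intro t ht
      apply (c9_diff x hx ε _ _ _).continuousAt
      · norm_num; linarith [ht.1, ht.2]
      · intro h
        have h1 := congrArg Complex.re h
        have h2 := congrArg Complex.im h
        norm_num at h1 h2
        rw [h2] at h1; norm_num at h1
  · intro t ht
    apply hP1
    · apply hball <;> norm_num <;> linarith [ht.1, ht.2]
    · by_cases h : t = 1
      · left; subst h; norm_num
      · right; norm_num; intro h'; apply h; linarith
  · intro t ht
    apply (c9_diff x hx ε _ _ _).continuousAt
    · norm_num; linarith [ht.1, ht.2]
    · intro h
      have h1 := congrArg Complex.re h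
      have h2 := congrArg Complex.im h
      norm_num at h1 h2
      have h3 : t = 1 := by linarith
      rw [h3] at h1; norm_num at h1

lemma c9_integrable (x : ℝ) (hx : 0 < x) (ε : ℤ) (hε : ε = 1 ∨ ε = -1) :
    Integrable (fun t : ℝ => f9 x ε ((-(3 / 5) : ℂ) + (t : ℂ) * Complex.I)) := by
  obtain ⟨C, hC, hb⟩ := c9_gamma_bound
  have hint : Integrable (fun t : ℝ => (1 + ‖t‖) ^ (-(11/10) : ℝ)) :=
    integrable_one_add_norm (by norm_num)
  refine (c9_cont_line x hx ε).locallyIntegrable.integrable_of_isBigO_cocompact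
    (g := fun t : ℝ => (1 + ‖t‖) ^ (-(11/10) : ℝ)) ?_ (hint.integrableAtFilter _)
  have hpi := Real.pi_pos
  refine Asymptotics.IsBigO.of_bound
    (C * (2:ℝ) ^ (11/10 : ℝ) * ((2 * Real.pi) ^ (3/5 : ℝ) * x ^ (3/5:ℝ))) ?_
  have hev : ∀ᶠ t : ℝ in cocompact ℝ, 1 ≤ ‖t‖ :=
    (tendsto_norm_cocompact_atTop (E := ℝ)).eventually (eventually_ge_atTop 1)
  filter_upwards [hev] with t ht
  have ht' : 1 ≤ |t| := ht
  have ht0 : 0 < |t| := by linarith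
  have h2pi : (2 * Real.pi : ℂ) = ((2 * Real.pi : ℝ) : ℂ) := by push_cast; rfl
  unfold f9
  rw [norm_mul, norm_mul, norm_mul, h2pi, Complex.norm_cpow_eq_rpow_re_of_pos (by positivity),
    Complex.norm_cpow_eq_rpow_re_of_pos hx, Complex.norm_exp]
  have e1 : (-((-(3 / 5) : ℂ) + (t : ℂ) * Complex.I)).re = 3/5 := by norm_num
  have e2 : (ε * Real.pi * Complex.I * ((-(3 / 5) : ℂ) + (t : ℂ) * Complex.I) / 2 : ℂ).re
     = - (ε * Real.pi * t / 2) := by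
    have : (ε * Real.pi * Complex.I * ((-(3 / 5) : ℂ) + (t : ℂ) * Complex.I) / 2 : ℂ) =
      ((- (ε * Real.pi * t / 2) : ℝ) : ℂ) + ((- (3/10) * ε * Real.pi : ℝ) : ℂ) * Complex.I := by
      push_cast
      linear_combination (ε * Real.pi * t / 2 : ℂ) * Complex.I_sq
    rw [this]; simp
  rw [e1, e2]
  have e3 : Real.exp (-(ε * Real.pi * t / 2)) ≤ Real.exp (Real.pi * |t| / 2) := by
    rw [Real.exp_le_exp]
    rcases hε with rfl | rfl
    · push_cast; nlinarith [neg_abs_le t]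
    · push_cast; nlinarith [le_abs_self t]
  have e4 : |t| ^ (-(11/10) : ℝ) ≤ (2:ℝ) ^ (11/10 : ℝ) * (1 + ‖t‖) ^ (-(11/10) : ℝ) := by
    have : ((1 + ‖t‖) / 2) ^ (-(11/10) : ℝ) = (2:ℝ) ^ (11/10 : ℝ) * (1 + ‖t‖) ^ (-(11/10) : ℝ) := by
      rw [Real.div_rpow (by positivity) (by norm_num), Real.rpow_neg (x := 2) (by norm_num)]
      field_simp
    rw [← this]
    apply Real.rpow_le_rpow_of_nonpos (by positivity) _ (by norm_num)
    rw [Real.norm_eq_abs]; linarith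
  rw [Real.norm_of_nonneg (by positivity : (0:ℝ) ≤ (1 + ‖t‖) ^ (-(11/10) : ℝ))]
  have e5 : Real.exp (-Real.pi * |t| / 2) * Real.exp (Real.pi * |t| / 2) = 1 := by
    rw [← Real.exp_add, ← Real.exp_zero]; congr 1; ring
  set A := (2 * Real.pi) ^ (3/5 : ℝ)
  set B := x ^ (3/5:ℝ)
  have hA : 0 < A := by positivity
  have hB : 0 < B := by positivity
  calc _ ≤ (C * |t| ^ (-(11/10) : ℝ) * Real.exp (-Real.pi * |t| / 2)) * A *
        Real.exp (Real.pi * |t| / 2) * B := by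
        gcongr
        exact hb t ht'
    _ = C * |t| ^ (-(11/10) : ℝ) * (A * B) *
         (Real.exp (-Real.pi * |t| / 2) * Real.exp (Real.pi * |t| / 2)) := by ring
    _ ≤ C * ((2:ℝ) ^ (11/10 : ℝ) * (1 + ‖t‖) ^ (-(11/10) : ℝ)) * (A * B) * 1 := by
        rw [e5]; gcongr
    _ = _ := by ring

lemma c9_mellin_eq (ε : ℤ) (hε : ε = 1 ∨ ε = -1) (s : ℂ) (h1 : -1 < s.re) (h0 : s.re < 0) :
    mellin (fun y : ℝ => Complex.exp (-(-(ε * Complex.I)) * y) - 1) s =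
      Complex.Gamma s * Complex.exp (ε * Real.pi * Complex.I * s / 2) := by
  rw [c9_mellin_bdry s h1 h0 _ (by simp) (by rcases hε with rfl | rfl <;> simp)]
  congr 1
  rw [Complex.cpow_def_of_ne_zero (by rcases hε with rfl | rfl <;> simp)]
  congr 1
  rcases hε with rfl | rfl
  · simp [Complex.log_neg_I]; ring
  · simp [Complex.log_I]; ring

lemma c9_f9_eq (x : ℝ) (hx : 0 < x) (ε : ℤ) (s : ℂ) :
    f9 x ε s = ((2 * Real.pi * x : ℝ) : ℂ) ^ (-s) *
      (Complex.Gamma s * Complex.exp (ε * Real.pi * Complex.I * s / 2)) := by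
  have h := Complex.mul_cpow_ofReal_nonneg (a := 2 * Real.pi) (b := x)
    (by have := Real.pi_pos; positivity) hx.le (-s)
  rw [Complex.ofReal_mul (2 * Real.pi) x, h]
  unfold f9
  push_cast
  ring

lemma c9_line (x : ℝ) (hx : 0 < x) (ε : ℤ) (hε : ε = 1 ∨ ε = -1) :
    ∫ t : ℝ, f9 x ε ((-(3 / 5) : ℂ) + (t : ℂ) * Complex.I) =
      2 * Real.pi * (Complex.exp (2 * Real.pi * Complex.I * ε * x) - 1) := by
  have hpi := Real.pi_pos
  have hσ : (((-(3/5) : ℝ)) : ℂ) = (-(3 / 5) : ℂ) := by push_cast; rfl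
  have hm : ∀ t : ℝ, mellin (fun y : ℝ => Complex.exp (-(-(ε * Complex.I)) * y) - 1)
      ((-(3 / 5) : ℂ) + (t : ℂ) * Complex.I) =
      Complex.Gamma ((-(3 / 5) : ℂ) + (t : ℂ) * Complex.I) *
       Complex.exp (ε * Real.pi * Complex.I * ((-(3 / 5) : ℂ) + (t : ℂ) * Complex.I) / 2) :=
    fun t => c9_mellin_eq ε hε _ (by norm_num) (by norm_num)
  have inv := mellinInv_mellin_eq (-(3/5)) (fun y : ℝ => Complex.exp (-(-(ε * Complex.I)) * y) - 1)
    (x := 2 * Real.pi * x) (by positivity) ?_ ?_ ?_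
  · unfold mellinInv at inv
    rw [hσ] at inv
    simp_rw [hm, smul_eq_mul, ← c9_f9_eq x hx ε] at inv
    rw [Complex.real_smul] at inv
    have e : Complex.exp (2 * Real.pi * Complex.I * ε * x) =
      Complex.exp (-(-(ε * Complex.I)) * ((2 * Real.pi * x : ℝ) : ℂ)) := by
      congr 1; push_cast; ring
    rw [e, ← inv]
    push_cast
    rw [← mul_assoc, mul_one_div_cancel c9_two_pi_ne, one_mul]
  · apply c9_conv _ (by fun_prop) _ _ (by norm_num) (by norm_num)
    apply c9_exp_bound _ (by simp)
    rcases hε with rfl | rfl <;> simp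
  · unfold Complex.VerticalIntegrable
    have h := c9_integrable (1 / (2 * Real.pi)) (by positivity) ε hε
    refine h.congr ?_
    filter_upwards with t
    rw [hσ, hm, c9_f9_eq _ (by positivity)]
    have : 2 * Real.pi * (1 / (2 * Real.pi)) = 1 := by field_simp
    rw [this]; simp
  · fun_prop

end Helpers

/-- The contour integral of `Γ(ξ)(2π)^{−ξ} e^{εiπξ/2} x^{−ξ}` along the upward-oriented
contour `𝒞` consisting of the ray from `−3/5 − i∞` to `−3/5 − i`, the segment from
`−3/5 − i` to `1/10`, the segment from `1/10` to `−3/5 + i`, and the ray from `−3/5 + i`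
to `−3/5 + i∞`, converges absolutely on each piece, and `(1/2πi) ∫_𝒞 = e^{2πiεx}`. -/
theorem contour_integral_eq_exp (x : ℝ) (hx : 0 < x) (ε : ℤ) (hε : ε = 1 ∨ ε = -1) :
    IntegrableOn (fun t : ℝ => f9 x ε ((-(3 / 5) : ℂ) + (t : ℂ) * Complex.I) * Complex.I)
      (Set.Iic (-1 : ℝ)) ∧
    IntervalIntegrable (fun t : ℝ =>
        f9 x ε (((-(3 / 5) : ℂ) - Complex.I) +
            (t : ℂ) * ((1 / 10 : ℂ) - ((-(3 / 5) : ℂ) - Complex.I))) *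
          ((1 / 10 : ℂ) - ((-(3 / 5) : ℂ) - Complex.I))) volume 0 1 ∧
    IntervalIntegrable (fun t : ℝ =>
        f9 x ε ((1 / 10 : ℂ) +
            (t : ℂ) * (((-(3 / 5) : ℂ) + Complex.I) - (1 / 10 : ℂ))) *
          (((-(3 / 5) : ℂ) + Complex.I) - (1 / 10 : ℂ))) volume 0 1 ∧
    IntegrableOn (fun t : ℝ => f9 x ε ((-(3 / 5) : ℂ) + (t : ℂ) * Complex.I) * Complex.I)
      (Set.Ici (1 : ℝ)) ∧
    (1 / (2 * Real.pi * Complex.I)) *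
      ((∫ t in Set.Iic (-1 : ℝ), f9 x ε ((-(3 / 5) : ℂ) + (t : ℂ) * Complex.I) * Complex.I) +
        (∫ t in (0 : ℝ)..1,
          f9 x ε (((-(3 / 5) : ℂ) - Complex.I) +
              (t : ℂ) * ((1 / 10 : ℂ) - ((-(3 / 5) : ℂ) - Complex.I))) *
            ((1 / 10 : ℂ) - ((-(3 / 5) : ℂ) - Complex.I))) +
        (∫ t in (0 : ℝ)..1,
          f9 x ε ((1 / 10 : ℂ) +
              (t : ℂ) * (((-(3 / 5) : ℂ) + Complex.I) - (1 / 10 : ℂ))) *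
            (((-(3 / 5) : ℂ) + Complex.I) - (1 / 10 : ℂ))) +
        (∫ t in Set.Ici (1 : ℝ), f9 x ε ((-(3 / 5) : ℂ) + (t : ℂ) * Complex.I) * Complex.I))
      = Complex.exp (2 * Real.pi * Complex.I * ε * x) := by
  obtain ⟨h2, h3, h4⟩ := c9_local x hx ε
  have hi := (c9_integrable x hx ε hε).mul_const Complex.I
  refine ⟨hi.integrableOn, h2, h3, hi.integrableOn, ?_⟩
  have hl := c9_line x hx ε hε
  have hsum : (∫ t in Set.Iic (-1 : ℝ), f9 x ε ((-(3 / 5) : ℂ) + (t : ℂ) * Complex.I) * Complex.I) +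
      (∫ t in (-1 : ℝ)..1, f9 x ε ((-(3 / 5) : ℂ) + (t : ℂ) * Complex.I) * Complex.I) +
      (∫ t in Set.Ici (1 : ℝ), f9 x ε ((-(3 / 5) : ℂ) + (t : ℂ) * Complex.I) * Complex.I) =
      (∫ t : ℝ, f9 x ε ((-(3 / 5) : ℂ) + (t : ℂ) * Complex.I)) * Complex.I := by
    rw [← integral_mul_const, integral_Ici_eq_integral_Ioi]
    have := intervalIntegral.integral_Iic_sub_Iic (μ := volume) (a := (-1:ℝ)) (b := 1)
      hi.integrableOn hi.integrableOn
    rw [← this, ← intervalIntegral.integral_Iic_add_Ioi (b := (1:ℝ)) hi.integrableOn hi.integrableOn]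
    ring
  rw [hl] at hsum
  have hpi : (Real.pi : ℂ) ≠ 0 := by simp [Real.pi_ne_zero]
  rw [one_div, inv_mul_eq_iff_eq_mul₀ (by simp [hpi])]
  linear_combination hsum + h4
end
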